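/- arXiv:2111.13038 — 3 statements merged into one kernel-verified Lean document; each statement's English description precedes it below -/
import Mathlib

section
/- Let Alt_r(x,y) be an alternant code of degree r over F_q with extension degree m > 1. Then dim_{F_q}((Alt_r(x,y)^⊥)^{⋆2}) ≤ binom(rm+1, 2) − (m/2)·(r−1)·(r−2). -/
open Finset Polynomial

noncomputable section

/-- Componentwise (Schur) product of two linear codes of length `n` over `F`:
the `F`-linear span of `{c ⋆ d : c ∈ C, d ∈ D}`. -/
def schurProd {F : Type*} [Field F] {n : ℕ} (C D : Submodule F (Fin n → F)) :
    Submodule F (Fin n → F) :=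
  Submodule.span F {v | ∃ c ∈ C, ∃ d ∈ D, v = c * d}

/-- Dual code with respect to the standard bilinear form `⟨u,v⟩ = ∑ i, u i * v i`. -/
def dualCode {F : Type*} [Field F] {n : ℕ} (C : Submodule F (Fin n → F)) :
    Submodule F (Fin n → F) where
  carrier := {v | ∀ c ∈ C, ∑ i, v i * c i = 0}
  add_mem' := by
    intro a b ha hb c hc
    simp only [Set.mem_setOf_eq] at *
    simp [Pi.add_apply, add_mul, Finset.sum_add_distrib, ha c hc, hb c hc]
  zero_mem' := by
    intro c hc
    simp
  smul_mem' := by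
    intro t a ha c hc
    simp only [Set.mem_setOf_eq] at *
    simp [Pi.smul_apply, smul_eq_mul, mul_assoc, ← Finset.mul_sum, ha c hc]

/-- Image of a code under the componentwise `t`-th power map (as the span of the
image set, which is a linear code). For `t = q^i` this is `C^{q^i}`. -/
def powCode {F : Type*} [Field F] {n : ℕ} (t : ℕ) (C : Submodule F (Fin n → F)) :
    Submodule F (Fin n → F) :=
  Submodule.span F ((fun c : Fin n → F => fun j => c j ^ t) '' C)

/-- Generalized Reed–Solomon code of dimension `r`, support `x` and multiplier `y`. -/
def GRSCode {F : Type*} [Field F] {n : ℕ} (r : ℕ) (x y : Fin n → F) :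
    Submodule F (Fin n → F) :=
  Submodule.span F
    {v | ∃ P : F[X], P.degree < (r : WithBot ℕ) ∧ v = fun i => y i * P.eval (x i)}

variable (Fq Fqm : Type*) [Field Fq] [Field Fqm] [Algebra Fq Fqm]

/-- The componentwise trace map `F_{q^m}^n → F_q^n`, as an `F_q`-linear map. -/
def trVecLM (n : ℕ) : (Fin n → Fqm) →ₗ[Fq] (Fin n → Fq) :=
  LinearMap.pi fun i => (Algebra.trace Fq Fqm).comp (LinearMap.proj i)

/-- The trace code `Tr(C)` of an `F_{q^m}`-linear code `C`. -/
def traceCode {n : ℕ} (C : Submodule Fqm (Fin n → Fqm)) : Submodule Fq (Fin n → Fq) :=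
  Submodule.map (trVecLM Fq Fqm n) (C.restrictScalars Fq)

/-- The componentwise inclusion `F_q^n → F_{q^m}^n`, as an `F_q`-linear map. -/
def algVecLM (n : ℕ) : (Fin n → Fq) →ₗ[Fq] (Fin n → Fqm) :=
  LinearMap.pi fun i => (Algebra.linearMap Fq Fqm).comp (LinearMap.proj i)

/-- The alternant code `Alt_r(x,y) = GRS_r(x,y)^⊥ ∩ F_q^n`, a code over `F_q`. -/
def AltCode {n : ℕ} (r : ℕ) (x y : Fin n → Fqm) : Submodule Fq (Fin n → Fq) :=
  Submodule.comap (algVecLM Fq Fqm n) ((dualCode (GRSCode r x y)).restrictScalars Fq)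

/-- The codes `B_v`: `B_0 = Alt_{2r-1}(x, y^2)^⊥` and
`B_v = Alt_{r(q^v - q^{v-1} + 1)}(x, y^{q^v+1})^⊥` for `v ≥ 1`. -/
def BCode (q : ℕ) {n : ℕ} (r : ℕ) (x y : Fin n → Fqm) : ℕ → Submodule Fq (Fin n → Fq)
  | 0 => dualCode (AltCode Fq Fqm (2 * r - 1) x fun i => y i ^ 2)
  | (v + 1) =>
      dualCode (AltCode Fq Fqm (r * (q ^ (v + 1) - q ^ v + 1)) x
        fun i => y i ^ (q ^ (v + 1) + 1))

end

theorem linearIndependent_algVecLM {K L : Type*} [Field K] [Field L] [Algebra K L]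
    {ι : Type*} {n : ℕ} {b : ι → Fin n → K} (hb : LinearIndependent K b) :
    LinearIndependent L fun i => algVecLM K L n (b i) := by
  rw [linearIndependent_iff'] at hb ⊢
  intro s g hg i hi
  rw [← Module.forall_dual_apply_eq_zero_iff K]
  intro φ
  refine hb s (fun j => φ (g j)) ?_ i hi
  ext k
  have h := congrArg φ (congrFun hg k)
  simpa [algVecLM, mul_comm (g _), ← Algebra.smul_def, mul_comm (φ _)] using h

theorem finrank_le_of_algVecLM_mem {K L : Type*} [Field K] [Field L] [Algebra K L]
    {n : ℕ} (V : Submodule K (Fin n → K)) (W : Submodule L (Fin n → L))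
    (h : ∀ v ∈ V, algVecLM K L n v ∈ W) :
    Module.finrank K V ≤ Module.finrank L W := by
  let b := Module.finBasis K V
  have hb : LinearIndependent K fun i => (b i : Fin n → K) :=
    b.linearIndependent.map' V.subtype V.ker_subtype
  have hW : LinearIndependent L
      fun i => (⟨algVecLM K L n (b i), h _ (b i).2⟩ : W) :=
    LinearIndependent.of_comp W.subtype (linearIndependent_algVecLM hb)
  simpa using hW.fintype_card_le_finrank

theorem dualCode_dualCode_le {F : Type*} [Field F] {n : ℕ} (C : Submodule F (Fin n → F)) :
    dualCode (dualCode C) ≤ C := by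
  intro v hv
  by_contra hvC
  obtain ⟨f, hfv, hfC⟩ := Submodule.exists_le_ker_of_notMem hvC
  have hf (w : Fin n → F) : f w = ∑ i, w i * f (Pi.single i 1) := by
    conv_lhs => rw [pi_eq_sum_univ' w]
    simp [map_sum]
  refine hfv ?_
  rw [hf]
  refine hv (fun i => f (Pi.single i 1)) fun c hc => ?_
  have := hfC hc
  rw [LinearMap.mem_ker, hf] at this
  simpa only [mul_comm] using this

theorem dualCode_anti {F : Type*} [Field F] {n : ℕ} {C D : Submodule F (Fin n → F)}
    (h : C ≤ D) : dualCode D ≤ dualCode C :=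
  fun _ hv c hc => hv c (h hc)

theorem dualCode_traceCode_le_comap {K L : Type*} [Field K] [Field L] [Algebra K L]
    [FiniteDimensional K L] [Algebra.IsSeparable K L] {n : ℕ} (C : Submodule L (Fin n → L)) :
    dualCode (traceCode K L C) ≤
      Submodule.comap (algVecLM K L n) ((dualCode C).restrictScalars K) := by
  intro v hv c hc
  refine (traceForm_nondegenerate K L).1 _ fun b => ?_
  have h := hv _ (Submodule.mem_map_of_mem (f := trVecLM K L n) (C.smul_mem b hc))
  simpa [trVecLM, algVecLM, Algebra.traceForm_apply, Finset.sum_mul, mul_assoc, mul_comm b,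
    ← Algebra.smul_def] using h

theorem dualCode_altCode_le_traceCode {K L : Type*} [Field K] [Field L] [Algebra K L]
    [FiniteDimensional K L] [Algebra.IsSeparable K L] {n : ℕ} (r : ℕ) (x y : Fin n → L) :
    dualCode (AltCode K L r x y) ≤ traceCode K L (GRSCode r x y) :=
  (dualCode_anti (dualCode_traceCode_le_comap _)).trans (dualCode_dualCode_le _)

theorem algVecLM_mem_span_of_mem_dualCode_altCode {K L : Type*} [Field K] [Field L]
    [Algebra K L] [Fintype K] [Fintype L] {n : ℕ} (r : ℕ) (x y : Fin n → L)
    {v : Fin n → K} (hv : v ∈ dualCode (AltCode K L r x y)) :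
    algVecLM K L n v ∈ Submodule.span L
      {w | ∃ i < Module.finrank K L, ∃ k < r, w = (y * x ^ k) ^ Fintype.card K ^ i} := by
  obtain ⟨c, hc, rfl⟩ := dualCode_altCode_le_traceCode r x y hv
  have hsum : algVecLM K L n (trVecLM K L n c) =
      ∑ i ∈ range (Module.finrank K L), c ^ Fintype.card K ^ i := by
    ext j
    simp [algVecLM, trVecLM, FiniteField.algebraMap_trace_eq_sum_pow]
  rw [hsum]
  refine Submodule.sum_mem _ fun i hi => ?_
  obtain ⟨p, _⟩ := CharP.exists L
  have : Fact p.Prime := ⟨CharP.char_is_prime L p⟩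
  have : CharP K p := (Algebra.charP_iff K L p).2 inferInstance
  obtain ⟨e, -, he⟩ := FiniteField.card K p
  have hadd (a b : Fin n → L) :
      (a + b) ^ Fintype.card K ^ i = a ^ Fintype.card K ^ i + b ^ Fintype.card K ^ i := by
    ext j
    simp [he, ← pow_mul, add_pow_char_pow]
  have h0 : Fintype.card K ^ i ≠ 0 := pow_ne_zero _ Fintype.card_ne_zero
  clear hsum hv
  have hc' : c ∈ Submodule.span L {w | ∃ k < r, w = y * x ^ k} := by
    refine Submodule.span_le.2 ?_ hc
    rintro _ ⟨P, hP, rfl⟩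
    have hPe : (fun j => y j * P.eval (x j)) =
        ∑ k ∈ range r, P.coeff k • (y * x ^ k) := by
      ext j
      rcases eq_or_ne P 0 with rfl | hP0
      · simp
      · rw [eval_eq_sum_range' ((natDegree_lt_iff_degree_lt hP0).2 hP)]
        simp [Finset.mul_sum, mul_left_comm]
    rw [SetLike.mem_coe, hPe]
    exact Submodule.sum_mem _ fun k hk => Submodule.smul_mem _ _
      (Submodule.subset_span ⟨k, mem_range.1 hk, rfl⟩)
  clear hc
  induction hc' using Submodule.span_induction with
  | mem w hw =>
    obtain ⟨k, hk, rfl⟩ := hw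
    exact Submodule.subset_span ⟨i, mem_range.1 hi, k, hk, rfl⟩
  | zero => rw [zero_pow h0]; exact Submodule.zero_mem _
  | add a b _ _ ha hb => rw [hadd]; exact Submodule.add_mem _ ha hb
  | smul t a _ ha => rw [_root_.smul_pow]; exact Submodule.smul_mem _ _ ha

theorem finrank_schurProd_dual_altCode_le {K L : Type*} [Field K] [Field L]
    [Algebra K L] [Fintype K] [Fintype L] {n : ℕ} (r : ℕ) (x y : Fin n → L) :
    Module.finrank K
        (schurProd (dualCode (AltCode K L r x y)) (dualCode (AltCode K L r x y))) ≤
      Module.finrank K L * (2 * r - 1) +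
        (∑ i ∈ range (Module.finrank K L), i) * (r * r) := by
  classical
  set m := Module.finrank K L
  let g : ℕ → ℕ → Fin n → L := fun i k => (y * x ^ k) ^ Fintype.card K ^ i
  let S : Finset (Fin n → L) :=
    (range m ×ˢ range (2 * r - 1)).image (fun a => (y ^ 2 * x ^ a.2) ^ Fintype.card K ^ a.1) ∪
    (((range m).sigma fun i => range i) ×ˢ (range r ×ˢ range r)).image
      fun a => g a.1.1 a.2.1 * g a.1.2 a.2.2
  have hS : #S ≤ m * (2 * r - 1) + (∑ i ∈ range m, i) * (r * r) := by
    refine (card_union_le _ _).trans (add_le_add (card_image_le.trans ?_)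
      (card_image_le.trans ?_))
    · simp
    · simp
  refine le_trans ?_ ((finrank_span_finset_le_card (R := L) S).trans hS)
  refine finrank_le_of_algVecLM_mem _ _ fun v hv => ?_
  induction hv using Submodule.span_induction with
  | zero => rw [map_zero]; exact Submodule.zero_mem _
  | add a b _ _ ha hb => rw [map_add]; exact Submodule.add_mem _ ha hb
  | smul t a _ ha =>
    rw [map_smul, ← algebraMap_smul L t (algVecLM K L n a)]
    exact Submodule.smul_mem _ _ ha
  | mem w hw =>
    obtain ⟨c, hc, d, hd, rfl⟩ := hw
    have hcd : algVecLM K L n (c * d) = algVecLM K L n c * algVecLM K L n d := by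
      ext j
      simp [algVecLM]
    rw [hcd]
    have hmul := Submodule.mul_mem_mul (algVecLM_mem_span_of_mem_dualCode_altCode r x y hc)
      (algVecLM_mem_span_of_mem_dualCode_altCode r x y hd)
    rw [Submodule.span_mul_span] at hmul
    refine Submodule.span_mono ?_ hmul
    rintro _ ⟨_, ⟨i, hi, k, hk, rfl⟩, _, ⟨j, hj, l, hl, rfl⟩, rfl⟩
    simp only [S, coe_union, coe_image, Set.mem_union, Set.mem_image, mem_coe, mem_product,
      mem_sigma, mem_range]
    rcases lt_trichotomy i j with hij | rfl | hij
    · exact Or.inr ⟨(⟨j, i⟩, (l, k)), ⟨⟨hj, hij⟩, hl, hk⟩, mul_comm _ _⟩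
    · refine Or.inl ⟨(i, k + l), ⟨hi, by dsimp only; omega⟩, ?_⟩
      rw [← mul_pow]
      congr 1
      ring
    · exact Or.inr ⟨(⟨i, j⟩, (k, l)), ⟨⟨hi, hij⟩, hk, hl⟩, rfl⟩

/-- For an alternant code `Alt_r(x,y)` of degree `r` over `F_q`
with extension degree `m > 1`,
`dim_{F_q} ((Alt_r(x,y)^⊥)^{⋆2}) ≤ binom(rm+1, 2) − (m/2)(r−1)(r−2)`. -/
theorem finrank_sq_dual_altCode_le
    (q m n : ℕ) (hm : 1 < m)
    (Fq Fqm : Type*) [Field Fq] [Field Fqm] [Algebra Fq Fqm]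
    [Fintype Fq] [Fintype Fqm]
    (hq : Fintype.card Fq = q) (hqm : Fintype.card Fqm = q ^ m)
    (r : ℕ) (hr : 1 ≤ r)
    (x y : Fin n → Fqm) (hx : Function.Injective x) (hy : ∀ i, y i ≠ 0) :
    (Module.finrank Fq
        ↥(schurProd (dualCode (AltCode Fq Fqm r x y)) (dualCode (AltCode Fq Fqm r x y))) : ℚ) ≤
      (Nat.choose (r * m + 1) 2 : ℚ) - (m : ℚ) / 2 * ((r : ℚ) - 1) * ((r : ℚ) - 2) := by
  have hfin : Module.finrank Fq Fqm = m := by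
    refine Nat.pow_right_injective (Fintype.one_lt_card (α := Fq)) ?_
    change Fintype.card Fq ^ _ = Fintype.card Fq ^ m
    rw [← Module.card_eq_pow_finrank, hqm, hq]
  have h := finrank_schurProd_dual_altCode_le (K := Fq) r x y
  rw [hfin] at h
  have hsum : ((∑ i ∈ range m, i : ℕ) : ℚ) * 2 = m * (m - 1) := by
    have := congrArg (Nat.cast (R := ℚ)) (sum_range_id_mul_two m)
    rwa [Nat.cast_mul, Nat.cast_mul, Nat.cast_sub hm.le, Nat.cast_ofNat, Nat.cast_one] at this
  have hcast : ((2 * r - 1 : ℕ) : ℚ) = 2 * r - 1 := by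
    rw [Nat.cast_sub (by omega)]
    norm_num
  refine (Nat.cast_le (α := ℚ).2 h).trans_eq ?_
  rw [Nat.cast_add, Nat.cast_mul, Nat.cast_mul, hcast, Nat.cast_choose_two]
  push_cast at hsum ⊢
  linear_combination (r : ℚ) * r / 2 * hsum
end

section
/- Let C = GRS_r(x,y) over F_{q^m} with r ≥ 1. For every non-negative integer u, dim_{F_q} Tr(C ⋆ C^{q^u}) ≤ m·((r−1)(q^u+1)+1). -/
open Finset Polynomial

/-- The evaluation map `P ↦ (y i * P (x i))_i` whose image of `degreeLT` is the GRS code. -/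
noncomputable def grsEval {F : Type*} [Field F] {n : ℕ} (x y : Fin n → F) :
    F[X] →ₗ[F] (Fin n → F) :=
  LinearMap.pi fun i => y i • Polynomial.leval (x i)

theorem grsEval_apply {F : Type*} [Field F] {n : ℕ} (x y : Fin n → F) (P : F[X]) :
    grsEval x y P = fun i => y i * P.eval (x i) := by
  ext i
  simp [grsEval, Polynomial.leval]

theorem GRSCode_eq_map {F : Type*} [Field F] {n : ℕ} (r : ℕ) (x y : Fin n → F) :
    GRSCode r x y = (degreeLT F r).map (grsEval x y) := by
  rw [GRSCode, ← Submodule.span_eq ((degreeLT F r).map (grsEval x y))]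
  congr 1
  ext v
  simp only [Set.mem_ofPred_eq, SetLike.mem_coe, Submodule.mem_map, mem_degreeLT, grsEval_apply,
    eq_comm]

theorem mem_GRSCode_succ {F : Type*} [Field F] {n : ℕ} {k : ℕ} {x y v : Fin n → F} :
    v ∈ GRSCode (k + 1) x y ↔ ∃ P : F[X], P.natDegree ≤ k ∧ v = fun i => y i * P.eval (x i) := by
  simp only [GRSCode_eq_map, degreeLT_succ_eq_degreeLE, Submodule.mem_map, mem_degreeLE,
    grsEval_apply, eq_comm (b := v), natDegree_le_iff_degree_le]

theorem finrank_GRSCode_le {F : Type*} [Field F] {n : ℕ} (r : ℕ) (x y : Fin n → F) :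
    Module.finrank F (GRSCode r x y) ≤ r := by
  have : Module.Finite F (degreeLT F r) := Module.Finite.equiv (degreeLTEquiv F r).symm
  rw [GRSCode_eq_map]
  refine (Submodule.finrank_map_le _ _).trans ?_
  rw [(degreeLTEquiv F r).finrank_eq, Module.finrank_fin_fun]

theorem powCode_GRSCode_le {F : Type*} [Field F] {n : ℕ} (t k : ℕ) (x y : Fin n → F) :
    powCode t (GRSCode (k + 1) x y) ≤ GRSCode (t * k + 1) x (y ^ t) := by
  refine Submodule.span_le.2 ?_
  rintro _ ⟨c, hc, rfl⟩
  obtain ⟨P, hP, rfl⟩ := mem_GRSCode_succ.1 hc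
  refine mem_GRSCode_succ.2 ⟨P ^ t, natDegree_pow_le_of_le t hP, ?_⟩
  ext i
  simp [mul_pow]

theorem schurProd_GRSCode_le {F : Type*} [Field F] {n : ℕ} (k l : ℕ) (x y z : Fin n → F) :
    schurProd (GRSCode (k + 1) x y) (GRSCode (l + 1) x z) ≤ GRSCode (k + l + 1) x (y * z) := by
  refine Submodule.span_le.2 ?_
  rintro _ ⟨c, hc, d, hd, rfl⟩
  obtain ⟨P, hP, rfl⟩ := mem_GRSCode_succ.1 hc
  obtain ⟨Q, hQ, rfl⟩ := mem_GRSCode_succ.1 hd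
  refine mem_GRSCode_succ.2 ⟨P * Q, natDegree_mul_le_of_le hP hQ, ?_⟩
  ext i
  simp only [Pi.mul_apply, eval_mul]
  ring

theorem schurProd_mono_right {F : Type*} [Field F] {n : ℕ} (C : Submodule F (Fin n → F))
    {D E : Submodule F (Fin n → F)} (h : D ≤ E) : schurProd C D ≤ schurProd C E :=
  Submodule.span_mono fun _ ⟨c, hc, d, hd, hv⟩ => ⟨c, hc, d, h hd, hv⟩

theorem finrank_traceCode_le (Fq Fqm : Type*) [Field Fq] [Field Fqm] [Algebra Fq Fqm]
    [FiniteDimensional Fq Fqm] {n : ℕ} (C : Submodule Fqm (Fin n → Fqm)) :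
    Module.finrank Fq (traceCode Fq Fqm C) ≤ Module.finrank Fq Fqm * Module.finrank Fqm C :=
  (Submodule.finrank_map_le _ _).trans_eq (Module.finrank_mul_finrank Fq Fqm C).symm

/-- For `C = GRS_r(x,y)` and any non-negative integer `u`,
`dim_{F_q} Tr(C ⋆ C^{q^u}) ≤ m·((r−1)(q^u+1)+1)`. -/
theorem finrank_traceCode_schur_frob_le
    (q m n : ℕ) (hm : 1 < m)
    (Fq Fqm : Type*) [Field Fq] [Field Fqm] [Algebra Fq Fqm]
    [Fintype Fq] [Fintype Fqm]
    (hq : Fintype.card Fq = q) (hqm : Fintype.card Fqm = q ^ m)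
    (r : ℕ) (hr : 1 ≤ r) (u : ℕ)
    (x y : Fin n → Fqm) (hx : Function.Injective x) (hy : ∀ i, y i ≠ 0) :
    Module.finrank Fq
        ↥(traceCode Fq Fqm (schurProd (GRSCode r x y) (powCode (q ^ u) (GRSCode r x y)))) ≤
      m * ((r - 1) * (q ^ u + 1) + 1) := by
  have hfin : Module.finrank Fq Fqm = m := by
    have h := Module.card_eq_pow_finrank (K := Fq) (V := Fqm)
    rw [hqm, hq] at h
    exact (Nat.pow_right_injective (hq ▸ Fintype.one_lt_card) h).symm
  obtain ⟨k, rfl⟩ := Nat.exists_eq_add_of_le' hr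
  refine (finrank_traceCode_le Fq Fqm _).trans ?_
  rw [hfin]
  refine Nat.mul_le_mul_left m ?_
  refine (Submodule.finrank_mono ((schurProd_mono_right _ (powCode_GRSCode_le _ _ _ _)).trans
    (schurProd_GRSCode_le _ _ _ _ _))).trans ((finrank_GRSCode_le _ _ _).trans_eq ?_)
  rw [Nat.add_sub_cancel]
  ring
end

section
/- Let Γ ∈ F_{q^m}[X] have degree r ≥ 1, let x ∈ F_{q^m}^n have pairwise distinct entries with Γ(x_i) ≠ 0 for all i, let y_i = 1/Γ(x_i), and let C = GRS_r(x,y). Then for every positive integer v, Tr(C ⋆ C^{q^v}) ⊆ B_v. -/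
open Finset Polynomial

theorem natDegree_lt_of_degree_lt {R : Type*} [Semiring R] {p : R[X]} {r : ℕ} (hr : 0 < r)
    (hp : p.degree < (r : WithBot ℕ)) : p.natDegree < r := by
  rcases eq_or_ne p 0 with rfl | h0
  · simpa
  · exact (natDegree_lt_iff_degree_lt h0).mpr hp

/-- The natural degree of a polynomial quotient over a field. -/
theorem natDegree_div_eq_sub {F : Type*} [Field F] (p : F[X]) {q : F[X]} (hq : q ≠ 0) :
    (p / q).natDegree = p.natDegree - q.natDegree := by
  rw [Polynomial.div_def, natDegree_C_mul (by simpa using hq),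
    natDegree_divByMonic _ (monic_mul_leadingCoeff_inv hq),
    natDegree_mul_leadingCoeff_inv _ hq]

theorem mem_GRSCode_iff {F : Type*} [Field F] {n r : ℕ} {x y c : Fin n → F} :
    c ∈ GRSCode r x y ↔
      ∃ P : F[X], P.degree < (r : WithBot ℕ) ∧ c = fun i => y i * P.eval (x i) := by
  refine ⟨fun h => ?_, fun h => Submodule.subset_span h⟩
  refine Submodule.span_induction (p := fun c _ => ∃ P : F[X], P.degree < (r : WithBot ℕ) ∧
    c = fun i => y i * P.eval (x i)) (fun _ h => h) ?_ ?_ ?_ h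
  · exact ⟨0, by simp, by ext; simp⟩
  · rintro _ _ _ _ ⟨P, hP, rfl⟩ ⟨Q, hQ, rfl⟩
    exact ⟨P + Q, (degree_add_le P Q).trans_lt (max_lt hP hQ), by ext; simp [mul_add]⟩
  · rintro t _ _ ⟨P, hP, rfl⟩
    exact ⟨t • P, (degree_smul_le t P).trans_lt hP, by ext; simp [mul_left_comm]⟩

/-- A linear functional vanishing on the products of the Reed–Solomon generators vanishes on
`C ⋆ C^{t}`. -/
theorem sum_mul_eq_zero_of_mem_schurProd_powCode {F : Type*} [Field F] {n r t : ℕ}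
    {x y a : Fin n → F}
    (h : ∀ P Q : F[X], P.degree < (r : WithBot ℕ) → Q.degree < (r : WithBot ℕ) →
      ∑ i, a i * (y i ^ (t + 1) * (P * Q ^ t).eval (x i)) = 0)
    {w : Fin n → F} (hw : w ∈ schurProd (GRSCode r x y) (powCode t (GRSCode r x y))) :
    ∑ i, a i * w i = 0 := by
  let f : (Fin n → F) →ₗ[F] F := Fintype.linearCombination F a
  have hf (w : Fin n → F) : f w = ∑ i, a i * w i := by
    simp [f, Fintype.linearCombination_apply, mul_comm]
  rw [← hf, ← LinearMap.mem_ker]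
  refine Submodule.span_le.mpr ?_ hw
  rintro _ ⟨c, hc, d, hd, rfl⟩
  obtain ⟨P, hP, rfl⟩ := mem_GRSCode_iff.mp hc
  let g : (Fin n → F) →ₗ[F] F :=
    f.comp (LinearMap.mulLeft F fun i => y i * P.eval (x i))
  change d ∈ LinearMap.ker g
  refine Submodule.span_le.mpr ?_ hd
  rintro _ ⟨d, hd, rfl⟩
  obtain ⟨Q, hQ, rfl⟩ := mem_GRSCode_iff.mp hd
  change f _ = 0
  rw [hf, ← h P Q hP hQ]
  refine Finset.sum_congr rfl fun i _ => ?_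
  simp only [LinearMap.mulLeft_apply, Pi.mul_apply, eval_mul, eval_pow]
  ring

/-- If the weighted sums of `R / Γ ^ (k + j)` vanish for `R` of degree less than that of `Γ ^ j`,
then `P / Γ ^ (k + j)` may be replaced by the quotient of `P` by `Γ ^ j`, divided by `Γ ^ k`. -/
theorem sum_eval_eq_sum_eval_div {F : Type*} [Field F] {n : ℕ} {a x y : Fin n → F} {Γ : F[X]}
    (hΓ : Γ ≠ 0) (hy : ∀ i, y i * Γ.eval (x i) = 1) (k j : ℕ) (P : F[X])
    (hmod : ∀ R : F[X], R.degree < (Γ ^ j).degree →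
      ∑ i, a i * (y i ^ (k + j) * R.eval (x i)) = 0) :
    ∑ i, a i * (y i ^ (k + j) * P.eval (x i)) =
      ∑ i, a i * (y i ^ k * (P / Γ ^ j).eval (x i)) := by
  have h := hmod (P % Γ ^ j) (degree_mod_lt _ (pow_ne_zero _ hΓ))
  rw [← sub_eq_zero, ← Finset.sum_sub_distrib, ← h]
  refine Finset.sum_congr rfl fun i _ => ?_
  have hP : P.eval (x i) = Γ.eval (x i) ^ j * (P / Γ ^ j).eval (x i) + (P % Γ ^ j).eval (x i) := by
    conv_lhs => rw [← EuclideanDomain.div_add_mod P (Γ ^ j)]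
    simp
  have hyj : y i ^ j * Γ.eval (x i) ^ j = 1 := by rw [← mul_pow, hy, one_pow]
  rw [hP, pow_add]
  linear_combination a i * y i ^ k * (P / Γ ^ j).eval (x i) * hyj

/-- If the weights lie in `𝔽_q` and the weighted sums of `R / Γ ^ (q * e)` vanish for `R` of degree
less than that of `Γ ^ (q * e - e)`, then those of all proper fractions `P / Γ ^ e` vanish. -/
theorem sum_eq_zero_of_frobenius {Fq F : Type*} [Field Fq] [Field F] [Algebra Fq F] [Fintype Fq]
    {n : ℕ} {c : Fin n → Fq} {x y : Fin n → F} {Γ : F[X]} (hΓ : Γ ≠ 0)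
    (hy : ∀ i, y i * Γ.eval (x i) = 1) (e d : ℕ) (hd : Fintype.card Fq * e = e + d)
    (hmod : ∀ R : F[X], R.degree < (Γ ^ d).degree →
      ∑ i, algebraMap Fq F (c i) * (y i ^ (e + d) * R.eval (x i)) = 0)
    (P : F[X]) (hP : P.natDegree < e * Γ.natDegree) :
    ∑ i, algebraMap Fq F (c i) * (y i ^ e * P.eval (x i)) = 0 := by
  induction hN : P.natDegree using Nat.strong_induction_on generalizing P with
  | _ N ih =>
  have hq : 1 < Fintype.card Fq := Fintype.one_lt_card
  have hpow : (∑ i, algebraMap Fq F (c i) * (y i ^ e * P.eval (x i))) ^ Fintype.card Fq =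
      ∑ i, algebraMap Fq F (c i) * (y i ^ (e + d) * (P ^ Fintype.card Fq).eval (x i)) := by
    change FiniteField.frobeniusAlgHom Fq F _ = _
    rw [map_sum]
    refine Finset.sum_congr rfl fun i _ => ?_
    rw [map_mul, AlgHom.commutes, FiniteField.coe_frobeniusAlgHom]
    beta_reduce
    rw [mul_pow, ← pow_mul, mul_comm e, hd, eval_pow]
  rw [sum_eval_eq_sum_eval_div hΓ hy e d _ hmod] at hpow
  refine eq_zero_of_pow_eq_zero (n := Fintype.card Fq) ?_
  rw [hpow]
  rcases lt_or_ge (P ^ Fintype.card Fq).degree (Γ ^ d).degree with hlt | hge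
  · rw [(Polynomial.div_eq_zero_iff (pow_ne_zero _ hΓ)).mpr hlt]
    simp
  · have hdiv : (P ^ Fintype.card Fq / Γ ^ d).natDegree < N := by
      have hle := natDegree_le_natDegree hge
      rw [natDegree_div_eq_sub _ (pow_ne_zero _ hΓ), natDegree_pow, natDegree_pow]
      rw [natDegree_pow, natDegree_pow] at hle
      obtain ⟨s, hs⟩ := Nat.exists_eq_add_of_lt hq
      rw [hs] at hd hle ⊢
      have : d = s * e + e := by linarith
      subst this
      rw [hN] at hle hP ⊢
      rw [Nat.sub_lt_iff_lt_add hle]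
      nlinarith
    exact ih _ hdiv _ (hdiv.trans (hN ▸ hP)) rfl

/-- With `Γ` of degree `r ≥ 1`, `y_i = 1/Γ(x_i)` and
`C = GRS_r(x,y)`: for every positive integer `v`, `Tr(C ⋆ C^{q^v}) ⊆ B_v`. -/
theorem traceCode_schur_frob_le_BCode
    (q m n : ℕ) (hm : 1 < m)
    (Fq Fqm : Type*) [Field Fq] [Field Fqm] [Algebra Fq Fqm]
    [Fintype Fq] [Fintype Fqm]
    (hq : Fintype.card Fq = q) (hqm : Fintype.card Fqm = q ^ m)
    (r : ℕ) (hr : 1 ≤ r) (Γ : Polynomial Fqm) (hΓ : Γ.degree = (r : WithBot ℕ))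
    (x : Fin n → Fqm) (hx : Function.Injective x) (hΓx : ∀ i, Γ.eval (x i) ≠ 0)
    (y : Fin n → Fqm) (hy : ∀ i, y i = (Γ.eval (x i))⁻¹)
    (v : ℕ) (hv : 1 ≤ v) :
    traceCode Fq Fqm (schurProd (GRSCode r x y) (powCode (q ^ v) (GRSCode r x y))) ≤
      BCode Fq Fqm q r x y v := by
  obtain ⟨u, rfl⟩ := Nat.exists_eq_add_of_le' hv
  have hΓ0 : Γ ≠ 0 := by rintro rfl; simp at hΓ
  have hΓn : Γ.natDegree = r := natDegree_eq_of_degree_eq_some hΓ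
  have hy1 (i) : y i * Γ.eval (x i) = 1 := by rw [hy, inv_mul_cancel₀ (hΓx i)]
  rintro _ ⟨w, hw, rfl⟩ c hc
  have hq1 : 1 < q := hq ▸ Fintype.one_lt_card
  obtain ⟨d, hd⟩ : ∃ d, q * q ^ u = q ^ u + d :=
    Nat.exists_eq_add_of_le (Nat.le_mul_of_pos_left _ (by omega))
  have hexp : q ^ (u + 1) = q ^ u + d := by rw [pow_succ', hd]
  have hcancel : q ^ (u + 1) - q ^ u + 1 = d + 1 := by omega
  have hdeg (j : ℕ) : (Γ ^ j).degree = ((r * j : ℕ) : WithBot ℕ) := by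
    rw [degree_eq_natDegree (pow_ne_zero _ hΓ0), natDegree_pow, hΓn, mul_comm]
  have hzero (R : Fqm[X]) (hR : R.degree < (Γ ^ (d + 1)).degree) :
      ∑ i, algebraMap Fq Fqm (c i) * (y i ^ (q ^ u + (d + 1)) * R.eval (x i)) = 0 := by
    refine hc _ (mem_GRSCode_iff.mpr ⟨R, ?_, ?_⟩)
    · rwa [hcancel, ← hdeg]
    · rw [hexp, add_assoc]
  have hzero' (R : Fqm[X]) (hR : R.degree < (Γ ^ d).degree) :
      ∑ i, algebraMap Fq Fqm (c i) * (y i ^ (q ^ u + d) * R.eval (x i)) = 0 := by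
    rw [← hzero (R * Γ)]
    · refine Finset.sum_congr rfl fun i _ => ?_
      rw [eval_mul, ← add_assoc, pow_succ]
      linear_combination -(algebraMap Fq Fqm (c i) * y i ^ (q ^ u + d) * R.eval (x i)) * hy1 i
    · rw [degree_mul, pow_succ, degree_mul]
      exact WithBot.add_lt_add_right (degree_ne_bot.mpr hΓ0) hR
  have hsum : ∑ i, algebraMap Fq Fqm (c i) * w i = 0 := by
    refine sum_mul_eq_zero_of_mem_schurProd_powCode (fun P Q hP hQ => ?_) hw
    rw [hexp, add_assoc, sum_eval_eq_sum_eval_div hΓ0 hy1 _ _ _ hzero]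
    refine sum_eq_zero_of_frobenius hΓ0 hy1 _ d (hq ▸ hd) hzero' _ ?_
    have hPn : P.natDegree < r := natDegree_lt_of_degree_lt hr hP
    have hQn : Q.natDegree < r := natDegree_lt_of_degree_lt hr hQ
    have hmul : (P * Q ^ (q ^ u + d)).natDegree ≤ P.natDegree + (q ^ u + d) * Q.natDegree :=
      natDegree_mul_le.trans (Nat.add_le_add_left natDegree_pow_le _)
    have he : 0 < q ^ u := by positivity
    rw [natDegree_div_eq_sub _ (pow_ne_zero _ hΓ0), natDegree_pow, hΓn]
    have hpos : 0 < q ^ u * r := Nat.mul_pos he hr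
    have hQr := Nat.mul_le_mul_left (q ^ u + d) hQn.le
    have hsplit : (q ^ u + d) * r + r = q ^ u * r + (d + 1) * r := by ring
    omega
  change ∑ i, Algebra.trace Fq Fqm (w i) * c i = 0
  rw [← map_zero (Algebra.trace Fq Fqm), ← hsum, map_sum]
  refine Finset.sum_congr rfl fun i _ => ?_
  rw [← Algebra.smul_def, map_smul, smul_eq_mul, mul_comm]
end
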